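/- arXiv:1907.01121 — 4 statements merged into one kernel-verified Lean document; each statement's English description precedes it below -/
import Mathlib

section
/- Let n be a natural number, let σ, λ : Fin n → ℝ with σ i > 0 and λ i > 0 for all i, and let 0 < p ≤ 2. Then (p/2)·∑ᵢ σ i · (λ i)^((p−2)/2) − ∑ᵢ (σ i)^(p/2) + ((2 − p)/2)·∑ᵢ (λ i)^(p/2) ≥ 0. -/
/-- The graph of the concave function `x ↦ x ^ q` lies below its tangent line at `l`. -/
theorem rpow_le_tangent {q s l : ℝ} (hq : 0 ≤ q) (hq1 : q ≤ 1) (hs : 0 ≤ s) (hl : 0 < l) :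
    s ^ q ≤ q * (s * l ^ (q - 1)) + (1 - q) * l ^ q := by
  have h := Real.geom_mean_le_arith_mean2_weighted hq (sub_nonneg.2 hq1)
    (mul_nonneg hs (Real.rpow_nonneg hl.le (q - 1))) (Real.rpow_nonneg hl.le q)
    (add_sub_cancel q 1)
  rwa [Real.mul_rpow hs (Real.rpow_nonneg hl.le _), ← Real.rpow_mul hl.le,
    ← Real.rpow_mul hl.le, mul_assoc, ← Real.rpow_add hl,
    show (q - 1) * q + q * (1 - q) = 0 by ring, Real.rpow_zero, mul_one] at h

theorem stmt2 (n : ℕ) (σ lam : Fin n → ℝ) (hσ : ∀ i, 0 < σ i) (hlam : ∀ i, 0 < lam i)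
    (p : ℝ) (hp : 0 < p) (hp2 : p ≤ 2) :
    p / 2 * ∑ i, σ i * lam i ^ ((p - 2) / 2) - ∑ i, σ i ^ (p / 2)
      + (2 - p) / 2 * ∑ i, lam i ^ (p / 2) ≥ 0 := by
  rw [Finset.mul_sum, Finset.mul_sum, ← Finset.sum_sub_distrib, ← Finset.sum_add_distrib]
  refine Finset.sum_nonneg fun i _ => ?_
  have h := rpow_le_tangent (q := p / 2) (by linarith) (by linarith) (hσ i).le (hlam i)
  rw [show p / 2 - 1 = (p - 2) / 2 by ring, show 1 - p / 2 = (2 - p) / 2 by ring] at h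
  linarith
end

section
/- Let M̃ and M be n×n positive definite real symmetric matrices. Let σ : Fin n → ℝ be the eigenvalues of M̃ sorted in increasing order and let λ : Fin n → ℝ be the eigenvalues of M sorted in decreasing order. Then trace(M̃ * M) ≥ ∑ᵢ σ i · λ i. -/
theorem of_sq_mem_doublyStochastic {ι : Type*} [Fintype ι] [DecidableEq ι]
    {W : Matrix ι ι ℝ} (hW : W ∈ Matrix.unitaryGroup ι ℝ) :
    Matrix.of (fun i j => W i j ^ 2) ∈ doublyStochastic ℝ ι := by
  rw [mem_doublyStochastic_iff_sum]
  refine ⟨fun i j => sq_nonneg _, fun i => ?_, fun j => ?_⟩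
  · have h := congrFun (congrFun (Matrix.mem_unitaryGroup_iff.mp hW) i) i
    simpa [Matrix.mul_apply, Matrix.star_apply, pow_two] using h
  · have h := congrFun (congrFun (Matrix.mem_unitaryGroup_iff'.mp hW) j) j
    simpa [Matrix.mul_apply, Matrix.star_apply, pow_two] using h

theorem Antivary.sum_mul_le_sum_mul_mulVec {ι : Type*} [Fintype ι] [DecidableEq ι]
    {a b : ι → ℝ} (hab : Antivary a b) {D : Matrix ι ι ℝ} (hD : D ∈ doublyStochastic ℝ ι) :
    ∑ i, a i * b i ≤ a ⬝ᵥ D.mulVec b := by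
  obtain ⟨w, hw, hw1, rfl⟩ := exists_eq_sum_perm_of_mem_doublyStochastic hD
  have hperm (τ : Equiv.Perm ι) : a ⬝ᵥ (τ.permMatrix ℝ).mulVec b = ∑ i, a i * b (τ i) := by
    simp [Matrix.permMatrix_mulVec, dotProduct]
  rw [Matrix.sum_mulVec, dotProduct_sum]
  simp only [Matrix.smul_mulVec, dotProduct_smul, hperm, smul_eq_mul]
  calc ∑ i, a i * b i = ∑ τ, w τ * ∑ i, a i * b i := by rw [← Finset.sum_mul, hw1, one_mul]
    _ ≤ _ := Finset.sum_le_sum fun τ _ =>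
      mul_le_mul_of_nonneg_left hab.sum_mul_le_sum_mul_comp_perm (hw τ)

theorem Matrix.IsHermitian.exists_mem_unitaryGroup_trace_mul {ι : Type*} [Fintype ι]
    [DecidableEq ι] {A B : Matrix ι ι ℝ} (hA : A.IsHermitian) (hB : B.IsHermitian) :
    ∃ W ∈ Matrix.unitaryGroup ι ℝ,
      (A * B).trace = ∑ i, ∑ j, hA.eigenvalues i * (W i j ^ 2 * hB.eigenvalues j) := by
  set U := hA.eigenvectorUnitary
  set V := hB.eigenvectorUnitary
  refine ⟨(star U * V : Matrix.unitaryGroup ι ℝ), SetLike.coe_mem _, ?_⟩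
  set W : Matrix ι ι ℝ := ((star U * V : Matrix.unitaryGroup ι ℝ) : Matrix ι ι ℝ) with hW
  have hW' : W = star (U : Matrix ι ι ℝ) * V := rfl
  have hstar : star W = star (V : Matrix ι ι ℝ) * U := by rw [hW', star_mul, star_star]
  have key : (A * B).trace = (Matrix.diagonal hA.eigenvalues * W *
      (Matrix.diagonal hB.eigenvalues * star W)).trace := by
    have hA' : A = U * Matrix.diagonal hA.eigenvalues * star (U : Matrix ι ι ℝ) := by
      simpa [Unitary.conjStarAlgAut_apply, Function.comp_def] using hA.spectral_theorem
    have hB' : B = V * Matrix.diagonal hB.eigenvalues * star (V : Matrix ι ι ℝ) := by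
      simpa [Unitary.conjStarAlgAut_apply, Function.comp_def] using hB.spectral_theorem
    conv_lhs => rw [hA', hB', Matrix.mul_assoc, Matrix.mul_assoc, Matrix.trace_mul_comm]
    rw [hstar, hW']
    simp only [Matrix.mul_assoc]
  rw [key, Matrix.trace]
  refine Finset.sum_congr rfl fun i _ => ?_
  rw [Matrix.diag_apply, Matrix.mul_apply]
  refine Finset.sum_congr rfl fun j _ => ?_
  simp only [Matrix.diagonal_mul, Matrix.star_apply, star_trivial]
  ring

theorem stmt3 {n : ℕ} (Mt M : Matrix (Fin n) (Fin n) ℝ)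
    (hMt : Mt.PosDef) (hM : M.PosDef)
    (σ lam : Fin n → ℝ) (e f : Equiv.Perm (Fin n))
    (hσ : σ = hMt.isHermitian.eigenvalues ∘ e) (hmono : Monotone σ)
    (hlam : lam = hM.isHermitian.eigenvalues ∘ f) (hanti : Antitone lam) :
    (Mt * M).trace ≥ ∑ i, σ i * lam i := by
  obtain ⟨W, hW, htr⟩ :=
    hMt.isHermitian.exists_mem_unitaryGroup_trace_mul hM.isHermitian
  have hD := mem_doublyStochastic_iff_sum.mp (of_sq_mem_doublyStochastic hW)
  have hD' : (Matrix.of fun i j => W i j ^ 2).submatrix e f ∈ doublyStochastic ℝ (Fin n) :=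
    mem_doublyStochastic_iff_sum.mpr
      ⟨fun i j => hD.1 _ _, fun i => (Equiv.sum_comp f _).trans (hD.2.1 (e i)),
        fun j => (Equiv.sum_comp e fun i => W i (f j) ^ 2).trans (hD.2.2 (f j))⟩
  refine ((hmono.antivary hanti).sum_mul_le_sum_mul_mulVec hD').trans_eq ?_
  rw [htr, ← Equiv.sum_comp e]
  refine Finset.sum_congr rfl fun i _ => ?_
  rw [← Equiv.sum_comp f, ← Finset.mul_sum]
  simp [hσ, hlam, Matrix.mulVec, dotProduct]
end

section
/- Let M̃ and M be n×n positive definite real symmetric matrices and let 0 < p ≤ 2. Then trace(M̃^(p/2)) − (p/2)·trace(M̃ * M^((p−2)/2)) ≤ trace(M^(p/2)) − (p/2)·trace(M * M^((p−2)/2)). -/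
open Matrix in
/-- The trace of a product of functions of two symmetric matrices, as a double sum over their
eigenvalues weighted by the squared overlaps of the eigenvectors. -/
lemma Matrix.IsHermitian.trace_cfc_mul_cfc {ι : Type*} [Fintype ι] [DecidableEq ι]
    {A B : Matrix ι ι ℝ} (hA : A.IsHermitian) (hB : B.IsHermitian) (f g : ℝ → ℝ) :
    (hA.cfc f * hB.cfc g).trace = ∑ i, ∑ j, f (hA.eigenvalues i) * g (hB.eigenvalues j) *
      ((star (hA.eigenvectorUnitary : Matrix ι ι ℝ) * (hB.eigenvectorUnitary : Matrix ι ι ℝ)) i j)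
        ^ 2 := by
  set U : Matrix ι ι ℝ := (hA.eigenvectorUnitary : Matrix ι ι ℝ) with hU
  set V : Matrix ι ι ℝ := (hB.eigenvectorUnitary : Matrix ι ι ℝ) with hV
  have hf : hA.cfc f = U * diagonal (fun i => f (hA.eigenvalues i)) * star U := by
    simp only [IsHermitian.cfc, Unitary.conjStarAlgAut_apply, hU]
    rfl
  have hg : hB.cfc g = V * diagonal (fun i => g (hB.eigenvalues i)) * star V := by
    simp only [IsHermitian.cfc, Unitary.conjStarAlgAut_apply, hV]
    rfl
  have hW : star V * U = (star U * V)ᵀ := by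
    simp [star_eq_conjTranspose, conjTranspose_eq_transpose_of_trivial]
  have key : (hA.cfc f * hB.cfc g).trace
      = (diagonal (fun i => f (hA.eigenvalues i)) * (star U * V) *
          (diagonal (fun i => g (hB.eigenvalues i)) * (star U * V)ᵀ)).trace := by
    rw [hf, hg, ← hW]
    simp only [Matrix.mul_assoc]
    rw [Matrix.trace_mul_comm]
    simp only [Matrix.mul_assoc]
  rw [key, trace]
  refine Finset.sum_congr rfl fun i _ => ?_
  rw [diag_apply, mul_apply]
  refine Finset.sum_congr rfl fun j _ => ?_
  rw [diagonal_mul, diagonal_mul, transpose_apply]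
  ring

/-- The graph of `t ↦ t ^ s` with `0 ≤ s ≤ 1` lies below its tangent at `b`. -/
lemma Real.rpow_sub_mul_le_rpow_sub_mul {a b s : ℝ} (ha : 0 ≤ a) (hb : 0 < b) (hs : 0 ≤ s)
    (hs1 : s ≤ 1) :
    a ^ s - s * (a * b ^ (s - 1)) ≤ b ^ s - s * (b * b ^ (s - 1)) := by
  have h := rpow_one_add_le_one_add_mul_self (s := a / b - 1)
    (by linarith [div_nonneg ha hb.le]) hs hs1
  rw [add_sub_cancel, Real.div_rpow ha hb.le, div_le_iff₀ (Real.rpow_pos_of_pos hb s)] at h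
  rw [Real.rpow_sub_one hb.ne']
  have e : (1 + s * (a / b - 1)) * b ^ s
      = b ^ s + s * (a * (b ^ s / b)) - s * (b * (b ^ s / b)) := by
    field_simp
    ring
  linarith

theorem stmt4 {n : ℕ} (Mt M : Matrix (Fin n) (Fin n) ℝ)
    (hMt : Mt.PosDef) (hM : M.PosDef) (p : ℝ) (hp : 0 < p) (hp2 : p ≤ 2) :
    (hMt.isHermitian.cfc (fun t => t ^ (p / 2))).trace
        - p / 2 * (Mt * hM.isHermitian.cfc (fun t => t ^ ((p - 2) / 2))).trace
      ≤ (hM.isHermitian.cfc (fun t => t ^ (p / 2))).trace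
        - p / 2 * (M * hM.isHermitian.cfc (fun t => t ^ ((p - 2) / 2))).trace := by
  have one_cfc : ∀ {A : Matrix (Fin n) (Fin n) ℝ} (hA : A.IsHermitian),
      hA.cfc (fun _ => 1) = 1 := fun {A} hA => by
    rw [← hA.cfc_eq]
    exact cfc_const_one ℝ A hA.isSelfAdjoint
  have id_cfc : ∀ {A : Matrix (Fin n) (Fin n) ℝ} (hA : A.IsHermitian),
      hA.cfc (fun t => t) = A := fun {A} hA => by
    rw [← hA.cfc_eq]
    exact cfc_id' ℝ A hA.isSelfAdjoint
  have hmul : M * hM.isHermitian.cfc (fun t => t ^ ((p - 2) / 2))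
      = hM.isHermitian.cfc (fun t => t * t ^ ((p - 2) / 2)) := by
    have hc (f : ℝ → ℝ) : ContinuousOn f (spectrum ℝ M) :=
      (Matrix.finite_real_spectrum (A := M)).continuousOn f
    nth_rw 1 [← id_cfc hM.isHermitian]
    simp only [← hM.isHermitian.cfc_eq]
    rw [cfc_mul _ _ M (hc _) (hc _)]
  have e1 := hMt.isHermitian.trace_cfc_mul_cfc hM.isHermitian (fun t => t ^ (p / 2)) (fun _ => 1)
  have e2 := hMt.isHermitian.trace_cfc_mul_cfc hM.isHermitian (fun t => t)
    (fun t => t ^ ((p - 2) / 2))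
  have e3 := hMt.isHermitian.trace_cfc_mul_cfc hM.isHermitian (fun _ => 1) (fun t => t ^ (p / 2))
  have e4 := hMt.isHermitian.trace_cfc_mul_cfc hM.isHermitian (fun _ => 1)
    (fun t => t * t ^ ((p - 2) / 2))
  rw [one_cfc, mul_one] at e1
  rw [id_cfc] at e2
  rw [one_cfc, one_mul] at e3 e4
  rw [hmul, e1, e2, e3, e4]
  simp only [Finset.mul_sum, ← Finset.sum_sub_distrib]
  refine Finset.sum_le_sum fun i _ => Finset.sum_le_sum fun j _ => ?_
  have h := Real.rpow_sub_mul_le_rpow_sub_mul (hMt.eigenvalues_pos i).le (hM.eigenvalues_pos j)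
    (s := p / 2) (by linarith) (by linarith)
  rw [show p / 2 - 1 = (p - 2) / 2 by ring] at h
  have h' := mul_le_mul_of_nonneg_right h (sq_nonneg
    ((star (hMt.isHermitian.eigenvectorUnitary : Matrix (Fin n) (Fin n) ℝ) *
      (hM.isHermitian.eigenvectorUnitary : Matrix (Fin n) (Fin n) ℝ)) i j))
  linarith
end

section
/- (Descent property of the iteratively reweighted update for compositions h_i(g_i(x)).) Let X be a type, f : X → ℝ, μ ≥ 0, and for i in a finite index set let gᵢ : X → Matrix (Fin n) (Fin n) ℝ and let hᵢ : Matrix (Fin n) (Fin n) ℝ → ℝ be concave on all matrices and differentiable everywhere. Fix x ∈ X and set Lᵢ = fderiv ℝ hᵢ (gᵢ(x)). If x̃ ∈ X satisfies f(x̃) + μ·∑ᵢ Lᵢ(gᵢ(x̃)) ≤ f(x) + μ·∑ᵢ Lᵢ(gᵢ(x)), then f(x̃) + μ·∑ᵢ hᵢ(gᵢ(x̃)) ≤ f(x) + μ·∑ᵢ hᵢ(gᵢ(x)). -/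
open Matrix

attribute [local instance] Matrix.frobeniusNormedAddCommGroup Matrix.frobeniusNormedSpace

/-- A concave function lies below its tangent hyperplane at any point of differentiability. -/
theorem ConcaveOn.le_add_of_hasFDerivAt {E : Type*} [NormedAddCommGroup E] [NormedSpace ℝ E]
    {s : Set E} {φ : E → ℝ} {φ' : E →L[ℝ] ℝ} {a b : E} (hφ : ConcaveOn ℝ s φ)
    (ha : a ∈ s) (hb : b ∈ s) (hd : HasFDerivAt φ φ' a) :
    φ b ≤ φ a + (φ' b - φ' a) := by
  rw [← map_sub]
  have hc : ConcaveOn ℝ (AffineMap.lineMap a b ⁻¹' s) (φ ∘ AffineMap.lineMap (k := ℝ) a b) :=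
    hφ.comp_affineMap _
  have hline : HasDerivAt (φ ∘ AffineMap.lineMap (k := ℝ) a b) (φ' (b - a)) 0 := by
    refine HasFDerivAt.comp_hasDerivAt (0 : ℝ) ?_ AffineMap.hasDerivAt_lineMap
    simpa using hd
  have key := hc.slope_le_of_hasDerivAt (x := 0) (y := 1) (by simpa using ha)
    (by simpa using hb) one_pos hline
  simp only [slope_def_field, Function.comp_apply, AffineMap.lineMap_apply_zero,
    AffineMap.lineMap_apply_one, sub_zero, div_one] at key
  linarith

/-- Descent property of the iteratively reweighted update for compositions `hᵢ(gᵢ(x))`. -/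
theorem stmt9 {X : Type*} {ι : Type*} [Fintype ι] {n : ℕ}
    (f : X → ℝ) (μ : ℝ) (hμ : 0 ≤ μ)
    (g : ι → X → Matrix (Fin n) (Fin n) ℝ)
    (h : ι → Matrix (Fin n) (Fin n) ℝ → ℝ)
    (hconc : ∀ i, ConcaveOn ℝ Set.univ (h i))
    (hdiff : ∀ i, Differentiable ℝ (h i))
    (x xt : X)
    (L : ι → Matrix (Fin n) (Fin n) ℝ →L[ℝ] ℝ)
    (hL : ∀ i, L i = fderiv ℝ (h i) (g i x))
    (hstep : f xt + μ * ∑ i, L i (g i xt) ≤ f x + μ * ∑ i, L i (g i x)) :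
    f xt + μ * ∑ i, h i (g i xt) ≤ f x + μ * ∑ i, h i (g i x) := by
  have tangent : ∀ i, h i (g i xt) - h i (g i x) ≤ L i (g i xt) - L i (g i x) := by
    intro i
    have key := (hconc i).le_add_of_hasFDerivAt (Set.mem_univ (g i x)) (Set.mem_univ (g i xt))
      (hdiff i (g i x)).hasFDerivAt
    rw [hL i]
    exact sub_le_iff_le_add'.mpr key
  have hsum := mul_le_mul_of_nonneg_left 
    (Finset.sum_le_sum fun i (_ : i ∈ Finset.univ) => tangent i) hμ
  simp only [Finset.sum_sub_distrib, mul_sub] at hsum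
  linarith
end
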